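/- The 5-state 2-symbol Turing machine M with transition table δ(A,0)=(1,R,B), δ(A,1)=(0,L,D), δ(B,0)=(1,L,C), δ(B,1)=(1,R,D), δ(C,0)=(1,L,A), δ(C,1)=(1,L,C), δ(D,0)=(1,R,H), δ(D,1)=(1,R,E), δ(E,0)=(1,R,A), δ(E,1)=(0,R,B), started in state A on the all-blank tape, halts after exactly 23,554,764 steps leaving exactly 4,097 non-blank cells on the tape. -/

import Mathlib

/-- Move direction of the tape head. -/
inductive Dir : Type
  | L
  | R

/-- The head displacement of a direction. -/
def Dir.move : Dir → ℤ
  | Dir.L => -1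
  | Dir.R => 1

/-- A Turing machine with `n` states and `k` symbols, in Rado's busy beaver model.
States are `Fin n` (state `A` is `0`, `B` is `1`, ...), symbols are `Fin k` with `0`
the blank symbol. A transition yields the written symbol, the move direction and the
next state, where `none` denotes the halting state `H`. -/
abbrev Machine (n k : ℕ) : Type :=
  Fin n → Fin k → Fin k × Dir × Option (Fin n)

/-- A configuration: current state (`none` = halted), head position, tape. -/
structure Cfg (n k : ℕ) where
  state : Option (Fin n)
  pos : ℤ
  tape : ℤ → Fin k

/-- One computation step (halted configurations are fixed). -/
def step {n k : ℕ} (M : Machine n k) (c : Cfg n k) : Cfg n k :=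
  match c.state with
  | none => c
  | some q =>
      { state := (M q (c.tape c.pos)).2.2
        pos := c.pos + (M q (c.tape c.pos)).2.1.move
        tape := Function.update c.tape c.pos (M q (c.tape c.pos)).1 }

/-- The initial configuration: state `A`, head at cell `0`, all-blank tape. -/
def init (n k : ℕ) [NeZero k] : Cfg n k :=
  { state := if h : 0 < n then some ⟨0, h⟩ else none
    pos := 0
    tape := fun _ => 0 }

/-- `HaltsIn M c t`: started from `c`, the machine `M` halts after exactly `t` steps. -/
def HaltsIn {n k : ℕ} (M : Machine n k) (c : Cfg n k) (t : ℕ) : Prop :=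
  ((step M)^[t] c).state = none ∧ ∀ i < t, ((step M)^[i] c).state ≠ none

/-- The number of non-blank cells of a configuration. -/
noncomputable def sigmaCount {n k : ℕ} [NeZero k] (c : Cfg n k) : ℕ :=
  Set.ncard {i : ℤ | c.tape i ≠ 0}

/-- Marxen and Buntrock's 5-state 2-symbol runner-up machine
(states `A,B,C,D,E` are `0,1,2,3,4`; `none` is the halting state `H`). -/
def M : Machine 5 2 :=
  ![![(1, Dir.R, some 1), (0, Dir.L, some 3)],
    ![(1, Dir.L, some 2), (1, Dir.R, some 3)],
    ![(1, Dir.L, some 0), (1, Dir.L, some 2)],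
    ![(1, Dir.R, none), (1, Dir.R, some 4)],
    ![(1, Dir.R, some 0), (0, Dir.R, some 1)]]

open Function

/-- The configuration in state `q` with head at `p`, whose tape reads `l 0, l 1, …` leftwards
from `p - 1` and `r 0, r 1, …` rightwards from `p`. -/
def splitCfg (q : Option (Fin 5)) (p : ℤ) (l r : Stream' (Fin 2)) : Cfg 5 2 where
  state := q
  pos := p
  tape i := if i < p then l.get (p - 1 - i).toNat else r.get (i - p).toNat

theorem step_splitCfg_right {q : Fin 5} {a b : Fin 2} {q' : Option (Fin 5)}
    (h : M q a = (b, Dir.R, q')) (p : ℤ) (l r : Stream' (Fin 2)) :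
    step M (splitCfg (some q) p l (r.cons a)) = splitCfg q' (p + 1) (l.cons b) r := by
  simp only [step, splitCfg, lt_irrefl, if_false, sub_self, Int.toNat_zero,
    Stream'.get_zero_cons, h, Dir.move, Cfg.mk.injEq, true_and]
  funext i
  rcases lt_trichotomy i p with hi | rfl | hi
  · obtain ⟨n, hn⟩ : ∃ n : ℕ, p - 1 - i = n := ⟨(p - 1 - i).toNat, by omega⟩
    have hn' : p + 1 - 1 - i = ((n + 1 : ℕ) : ℤ) := by omega
    rw [update_of_ne hi.ne, if_pos hi, if_pos (by omega), hn, hn']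
    rfl
  · simp
  · obtain ⟨n, hn⟩ : ∃ n : ℕ, i - (p + 1) = n := ⟨(i - (p + 1)).toNat, by omega⟩
    have hn' : i - p = ((n + 1 : ℕ) : ℤ) := by omega
    rw [update_of_ne hi.ne', if_neg (by omega), if_neg (by omega), hn, hn']
    rfl

theorem step_splitCfg_left {q : Fin 5} {a b : Fin 2} {q' : Option (Fin 5)}
    (h : M q a = (b, Dir.L, q')) (p : ℤ) (x : Fin 2) (l r : Stream' (Fin 2)) :
    step M (splitCfg (some q) p (l.cons x) (r.cons a)) =
      splitCfg q' (p - 1) l ((r.cons b).cons x) := by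
  simp only [step, splitCfg, lt_irrefl, if_false, sub_self, Int.toNat_zero,
    Stream'.get_zero_cons, h, Dir.move, Cfg.mk.injEq, true_and]
  refine ⟨rfl, funext fun i => ?_⟩
  rcases lt_trichotomy i p with hi | rfl | hi
  · rw [update_of_ne hi.ne, if_pos hi]
    rcases eq_or_ne i (p - 1) with rfl | hi'
    · simp
    · obtain ⟨n, hn⟩ : ∃ n : ℕ, p - 1 - 1 - i = n := ⟨(p - 1 - 1 - i).toNat, by omega⟩
      have hn' : p - 1 - i = ((n + 1 : ℕ) : ℤ) := by omega
      rw [if_pos (by omega), hn, hn']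
      rfl
  · rw [update_self, if_neg (by omega), show i - (i - 1) = ((1 : ℕ) : ℤ) by omega]
    rfl
  · obtain ⟨n, hn⟩ : ∃ n : ℕ, i - p = ((n + 1 : ℕ) : ℤ) := ⟨(i - p - 1).toNat, by omega⟩
    have hn' : i - (p - 1) = ((n + 1 + 1 : ℕ) : ℤ) := by omega
    rw [update_of_ne hi.ne', if_neg (by omega), if_neg (by omega), hn, hn']
    rfl

/-- `M` goes in `t` steps from state `q` and half-tapes `l`, `r` to state `q'` and half-tapes
`l'`, `r'`, wherever the head starts. -/
def Reaches (t : ℕ) (q : Option (Fin 5)) (l r : Stream' (Fin 2))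
    (q' : Option (Fin 5)) (l' r' : Stream' (Fin 2)) : Prop :=
  ∀ p, ∃ p', (step M)^[t] (splitCfg q p l r) = splitCfg q' p' l' r'

namespace Reaches

variable {t t' : ℕ} {q q' q'' : Option (Fin 5)} {l r l' r' l'' r'' : Stream' (Fin 2)}

theorem refl : Reaches 0 q l r q l r := fun p => ⟨p, rfl⟩

theorem trans (h : Reaches t q l r q' l' r') (h' : Reaches t' q' l' r' q'' l'' r'') :
    Reaches (t + t') q l r q'' l'' r'' := by
  intro p
  obtain ⟨p', hp⟩ := h p
  obtain ⟨p'', hp'⟩ := h' p'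
  exact ⟨p'', by rw [add_comm, iterate_add_apply, hp, hp']⟩

theorem congr_time (h : Reaches t q l r q' l' r') (e : t = t') :
    Reaches t' q l r q' l' r' := e ▸ h

theorem right {s : Fin 5} {a b : Fin 2} (h : M s a = (b, Dir.R, q')) :
    Reaches 1 (some s) l (r.cons a) q' (l.cons b) r :=
  fun p => ⟨_, step_splitCfg_right h p l r⟩

theorem left {s : Fin 5} {a b x : Fin 2} (h : M s a = (b, Dir.L, q')) :
    Reaches 1 (some s) (l.cons x) (r.cons a) q' l ((r.cons b).cons x) :=
  fun p => ⟨_, step_splitCfg_left h p x l r⟩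

end Reaches

theorem M_A0 : M 0 0 = (1, Dir.R, some 1) := rfl
theorem M_A1 : M 0 1 = (0, Dir.L, some 3) := rfl
theorem M_B0 : M 1 0 = (1, Dir.L, some 2) := rfl
theorem M_B1 : M 1 1 = (1, Dir.R, some 3) := rfl
theorem M_C0 : M 2 0 = (1, Dir.L, some 0) := rfl
theorem M_C1 : M 2 1 = (1, Dir.L, some 2) := rfl
theorem M_D0 : M 3 0 = (1, Dir.R, none) := rfl
theorem M_D1 : M 3 1 = (1, Dir.R, some 4) := rfl
theorem M_E0 : M 4 0 = (1, Dir.R, some 0) := rfl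
theorem M_E1 : M 4 1 = (0, Dir.R, some 1) := rfl

/-- The blank half-tape. -/
def blank : Stream' (Fin 2) := Stream'.const 0

theorem cons_zero_blank : Stream'.cons 0 blank = blank := (Stream'.const_eq 0).symm

namespace Reaches

variable {q' : Option (Fin 5)} {l : Stream' (Fin 2)} {s : Fin 5} {b x : Fin 2}

theorem right_blank (h : M s 0 = (b, Dir.R, q')) :
    Reaches 1 (some s) l blank q' (l.cons b) blank := by
  simpa only [cons_zero_blank] using Reaches.right (l := l) (r := blank) h

theorem left_blank (h : M s 0 = (b, Dir.L, q')) :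
    Reaches 1 (some s) (l.cons x) blank q' l ((blank.cons b).cons x) := by
  simpa only [cons_zero_blank] using Reaches.left (x := x) (l := l) (r := blank) h

end Reaches

/-- The half-tape `s` preceded by `m` ones. -/
def ones (m : ℕ) (s : Stream' (Fin 2)) : Stream' (Fin 2) := (Stream'.cons 1)^[m] s

theorem ones_succ (m : ℕ) (s : Stream' (Fin 2)) : ones (m + 1) s = (ones m s).cons 1 :=
  iterate_succ_apply' ..

theorem ones_cons_one (m : ℕ) (s : Stream' (Fin 2)) : ones m (s.cons 1) = (ones m s).cons 1 :=
  ones_succ m s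

theorem ones_add (m k : ℕ) (s : Stream' (Fin 2)) : ones (m + k) s = ones m (ones k s) :=
  iterate_add_apply ..

/-- The half-tape `s` preceded by `k` blocks `0 1 1`. -/
def blocks (k : ℕ) (s : Stream' (Fin 2)) : Stream' (Fin 2) :=
  (fun s => ((s.cons 1).cons 1).cons 0)^[k] s

theorem blocks_succ (k : ℕ) (s : Stream' (Fin 2)) :
    blocks (k + 1) s = (((blocks k s).cons 1).cons 1).cons 0 :=
  iterate_succ_apply' ..

theorem reaches_C_ones (m : ℕ) (l r : Stream' (Fin 2)) :
    Reaches (m + 1) (some 2) (ones m (l.cons 0)) (r.cons 1) (some 2) l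
      ((ones (m + 1) r).cons 0) := by
  induction m generalizing r with
  | zero => exact .left M_C1
  | succ m ih =>
    have h := (Reaches.left M_C1).trans (ih (r.cons 1))
    rw [ones_cons_one, ← ones_succ, ← ones_succ] at h
    exact h.congr_time (by ring)

theorem reaches_A_ones (m : ℕ) (l r : Stream' (Fin 2)) :
    Reaches (3 * m) (some 0) (l.cons 1) (ones m r) (some 0) (ones m (l.cons 1)) r := by
  induction m generalizing l with
  | zero => exact .refl
  | succ m ih =>
    have h := (((Reaches.left M_A1).trans (.right M_D1)).trans (.right M_E0)).trans (ih (l.cons 1))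
    rw [← ones_succ, ones_cons_one, ← ones_succ] at h
    exact h.congr_time (by ring)

theorem reaches_B_ones (k : ℕ) (l r : Stream' (Fin 2)) :
    Reaches (3 * k) (some 1) l (ones (3 * k) r) (some 1) (blocks k l) r := by
  induction k generalizing r with
  | zero => exact .refl
  | succ k ih =>
    have h := (ih (ones 3 r)).trans
      (((Reaches.right M_B1).trans (.right M_D1)).trans (.right M_E1))
    rw [← ones_add, ← blocks_succ] at h
    exact h.congr_time (by ring)

/-- A sweep to the left from the right end of a run of ones, up to the blank cell before it. -/
theorem reaches_fill_ones (m : ℕ) (l : Stream' (Fin 2)) (x : Fin 2) :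
    Reaches (m + 3) (some 1) (ones (m + 1) ((l.cons x).cons 0)) blank
      (some 0) l ((ones (m + 3) blank).cons x) := by
  have h := ((Reaches.left_blank M_B0).trans (reaches_C_ones m (l.cons x) _)).trans (.left M_C0)
  simp only [ones_cons_one, ← ones_succ] at h
  exact h.congr_time (by ring)

theorem reaches_absorb_block (m : ℕ) (l : Stream' (Fin 2)) :
    Reaches (4 * m + 20) (some 1) (ones (m + 2) (((l.cons 1).cons 1).cons 0)) blank
      (some 1) (ones (m + 7) l) blank := by
  have h := reaches_fill_ones (m + 1) (l.cons 1) 1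
  rw [← ones_succ] at h
  have h' := (h.trans (reaches_A_ones _ _ blank)).trans (.right_blank M_A0)
  simp only [ones_cons_one, ← ones_succ] at h'
  exact h'.congr_time (by ring)

theorem reaches_absorb_blocks (k m : ℕ) (l : Stream' (Fin 2)) :
    Reaches (10 * k ^ 2 + (4 * m + 10) * k) (some 1) (ones (m + 2) (blocks k l)) blank
      (some 1) (ones (m + 5 * k + 2) l) blank := by
  induction k generalizing m with
  | zero => exact Reaches.refl.congr_time (by ring)
  | succ k ih =>
    have h := (reaches_absorb_block m (blocks k l)).trans (ih (m + 5))
    rw [← blocks_succ, show m + 5 + 5 * k + 2 = m + 5 * (k + 1) + 2 by ring] at h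
    exact h.congr_time (by ring)

/-- From state `A` on the blank cell to the left of a run of `m` ones, `M` returns after `t`
steps to the same situation with a run of `n` ones. -/
def Grows (t m n : ℕ) : Prop :=
  Reaches t (some 0) blank ((ones m blank).cons 0) (some 0) blank ((ones n blank).cons 0)

theorem Grows.trans {t t' m n k : ℕ} (h : Grows t m n) (h' : Grows t' n k) :
    Grows (t + t') m k :=
  Reaches.trans h h'

theorem reaches_start (k i : ℕ) :
    Reaches (3 * k + 1) (some 0) blank ((ones (3 * k + i) blank).cons 0)
      (some 1) (blocks k (blank.cons 1)) (ones i blank) := by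
  rw [ones_add]
  exact ((Reaches.right M_A0).trans (reaches_B_ones k _ _)).congr_time (by ring)

theorem reaches_absorb_all (k m : ℕ) :
    Reaches (10 * k ^ 2 + (4 * m + 15) * k + m + 5)
      (some 1) (ones (m + 2) (blocks k (blank.cons 1))) blank
      (some 0) blank ((ones (m + 5 * k + 5) blank).cons 0) := by
  have h := reaches_fill_ones (m + 5 * k + 2) blank 0
  rw [cons_zero_blank, cons_zero_blank] at h
  have h' := reaches_absorb_blocks k m (blank.cons 1)
  rw [ones_cons_one, ← ones_succ] at h'
  exact (h'.trans h).congr_time (by ring)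

theorem grows_three_mul_add_two (k : ℕ) :
    Grows (10 * k ^ 2 + 26 * k + 12) (3 * k + 2) (5 * k + 7) := by
  have h := (((((reaches_start k 2).trans (.right M_B1)).trans (.right M_D1)).trans
    (.right_blank M_E0)).trans (.right_blank M_A0)).trans (reaches_absorb_all k 2)
  rw [show 2 + 5 * k + 5 = 5 * k + 7 by ring] at h
  exact h.congr_time (by ring)

theorem grows_three_mul_add_three (k : ℕ) :
    Grows (10 * k ^ 2 + 30 * k + 24) (3 * k + 3) (5 * k + 8) := by
  have start := reaches_start (k + 1) 0
  rw [blocks_succ] at start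
  have turn := (((start.trans (.left_blank M_B0)).trans (.left M_C0)).trans
    (reaches_A_ones 3 _ blank)).trans (.right_blank M_A0)
  rw [ones_cons_one, ← ones_succ, ← ones_succ] at turn
  have h := turn.trans (reaches_absorb_all k 3)
  rw [show 3 + 5 * k + 5 = 5 * k + 8 by ring] at h
  exact h.congr_time (by ring)

theorem reaches_D_blank (k : ℕ) :
    Reaches (3 * k + 2) (some 0) blank ((ones (3 * k + 1) blank).cons 0)
      (some 3) ((blocks k (blank.cons 1)).cons 1) blank :=
  (reaches_start k 1).trans (.right M_B1)

theorem init_eq_splitCfg : init 5 2 = splitCfg (some 0) 0 blank blank := by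
  simp [init, splitCfg, blank, Stream'.get_const]

theorem reaches_three_ones :
    Reaches 4 (some 0) blank blank (some 0) blank ((ones 3 blank).cons 0) := by
  have h := reaches_fill_ones 0 blank 0
  rw [cons_zero_blank, cons_zero_blank] at h
  exact (Reaches.right_blank M_A0).trans h

theorem grows_to_halting : Grows 23548616 3 6142 := by
  have h := grows_three_mul_add_three 0
    |>.trans (grows_three_mul_add_two 2)
    |>.trans (grows_three_mul_add_two 5)
    |>.trans (grows_three_mul_add_two 10)
    |>.trans (grows_three_mul_add_three 18)
    |>.trans (grows_three_mul_add_two 32)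
    |>.trans (grows_three_mul_add_two 55)
    |>.trans (grows_three_mul_add_three 93)
    |>.trans (grows_three_mul_add_two 157)
    |>.trans (grows_three_mul_add_three 263)
    |>.trans (grows_three_mul_add_three 440)
    |>.trans (grows_three_mul_add_three 735)
    |>.trans (grows_three_mul_add_two 1227)
  norm_num only at h
  exact h

/-- The number of non-blank cells of a half-tape. -/
noncomputable def weight (s : Stream' (Fin 2)) : ℕ∞ := Set.encard {n | s.get n ≠ 0}

theorem weight_cons (a : Fin 2) (s : Stream' (Fin 2)) :
    weight (s.cons a) = weight s + if a = 0 then 0 else 1 := by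
  have h : {n | (s.cons a).get n ≠ 0} = Nat.succ '' {n | s.get n ≠ 0} ∪ {n | n = 0 ∧ a ≠ 0} := by
    ext n
    cases n <;> simp [Stream'.get_succ_cons]
  rw [weight, h, Set.encard_union_eq, Nat.succ_injective.encard_image, weight]
  · split_ifs with ha <;> simp [ha]
  · rw [Set.disjoint_left]
    rintro _ ⟨n, -, rfl⟩ ⟨hn, -⟩
    exact n.succ_ne_zero hn

theorem weight_blank : weight blank = 0 := by
  simp [weight, blank, Stream'.get_const]

theorem weight_blocks (k : ℕ) (s : Stream' (Fin 2)) :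
    weight (blocks k s) = weight s + (2 * k : ℕ) := by
  induction k with
  | zero => simp [blocks]
  | succ k ih =>
    simp only [blocks_succ, weight_cons, ih]
    push_cast
    norm_num
    ring

theorem sigmaCount_splitCfg_blank (q : Option (Fin 5)) (p : ℤ) (l : Stream' (Fin 2)) :
    sigmaCount (splitCfg q p l blank) = (weight l).toNat := by
  have h : {i | (splitCfg q p l blank).tape i ≠ 0} =
      (fun n : ℕ => p - 1 - n) '' {n | l.get n ≠ 0} := by
    ext i
    simp only [splitCfg, blank, Stream'.get_const, Set.mem_ofPred_eq, Set.mem_image]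
    constructor
    · intro hi
      have hp : i < p := by
        by_contra hp
        simp [hp] at hi
      exact ⟨_, by simpa [hp] using hi, by omega⟩
    · rintro ⟨n, hn, rfl⟩
      rw [if_pos (by omega)]
      simpa using hn
  have inj : Injective fun n : ℕ => p - 1 - (n : ℤ) := fun a b hab => by
    simpa using hab
  rw [sigmaCount, h, Set.ncard, inj.encard_image, weight]

theorem iterate_step_of_halted {c : Cfg 5 2} (h : c.state = none) (t : ℕ) :
    ((step M)^[t] c).state = none := by
  rw [iterate_fixed (by simp [step, h]), h]

/-- Started on the all-blank tape, `M` halts after exactly 23,554,764 steps leaving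
exactly 4,097 non-blank cells. -/
theorem marxen_buntrock_runner_up :
    HaltsIn M (init 5 2) 23554764 ∧
    sigmaCount ((step M)^[23554764] (init 5 2)) = 4097 := by
  obtain ⟨p, hp⟩ := (reaches_three_ones.trans grows_to_halting).trans (reaches_D_blank 2047) 0
  rw [← init_eq_splitCfg] at hp
  norm_num only at hp
  have hs := iterate_succ_apply' (step M) 23554763 (init 5 2)
  rw [hp, ← cons_zero_blank, step_splitCfg_right M_D0, cons_zero_blank] at hs
  refine ⟨⟨by rw [hs]; rfl, fun i hi hn => ?_⟩, ?_⟩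
  · have h := iterate_step_of_halted hn (23554763 - i)
    rw [← iterate_add_apply, Nat.sub_add_cancel (Nat.le_of_lt_succ hi), hp] at h
    cases h
  · rw [hs, sigmaCount_splitCfg_blank, weight_cons, weight_cons, weight_blocks, weight_cons,
      weight_blank]
    rfl
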